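/- Let M be the 4×4 matrix with rows (1, 0, 0, 0), (1.4351, 0.6797, 3.9435, 7.7238), (−1.3085, 4.6694, 13.1949, 5.1509), (1.1573, 1.2007, 5.7272, 8.6591), where the decimal entries are taken as exact rational numbers. Then the set S(M) = {(t₁, t₂, s₁, s₂) ∈ ℂ⁴ : F(t₁, t₂, s₁, s₂; M) = 0, t₁ ≠ t₂, s₁ ≠ s₂} has exactly 40 elements and every element of S(M) lies in ℝ⁴; i.e., all ten common secant lines of the standard twisted cubic and its image under M are totally real. -/

import Mathlib

open Matrix

noncomputable section

/-- `v(a) = (1, a, a², a³) ∈ ℂ⁴`. -/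
def tcv (a : ℂ) : Fin 4 → ℂ := ![1, a, a ^ 2, a ^ 3]

/-- `pᵢ(s; M)`, the `i`-th coordinate of `M·v(s)`. -/
def pc (M : Matrix (Fin 4) (Fin 4) ℂ) (i : Fin 4) (s : ℂ) : ℂ := M.mulVec (tcv s) i

/-- `f₁(t₁, t₂, s; M) = p₃(s; M) − (t₁ + t₂)p₂(s; M) + t₁t₂p₁(s; M)`. -/
def f₁ (M : Matrix (Fin 4) (Fin 4) ℂ) (t₁ t₂ s : ℂ) : ℂ :=
  pc M 2 s - (t₁ + t₂) * pc M 1 s + t₁ * t₂ * pc M 0 s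

/-- `f₂(t₁, t₂, s; M) = p₄(s; M) − (t₁ + t₂)p₃(s; M) + t₁t₂p₂(s; M)`. -/
def f₂ (M : Matrix (Fin 4) (Fin 4) ℂ) (t₁ t₂ s : ℂ) : ℂ :=
  pc M 3 s - (t₁ + t₂) * pc M 2 s + t₁ * t₂ * pc M 1 s

/-- The square polynomial system `F(·; M)` viewed as a map `ℂ⁴ → ℂ⁴`, with the
variables ordered `(t₁, t₂, s₁, s₂)`. -/
def Fmap (M : Matrix (Fin 4) (Fin 4) ℂ) (x : Fin 4 → ℂ) : Fin 4 → ℂ :=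
  ![f₁ M (x 0) (x 1) (x 2), f₁ M (x 0) (x 1) (x 3),
    f₂ M (x 0) (x 1) (x 2), f₂ M (x 0) (x 1) (x 3)]

/-- `S(M)`: solutions of `F(·; M) = 0` with `t₁ ≠ t₂` and `s₁ ≠ s₂`. -/
def Ssol (M : Matrix (Fin 4) (Fin 4) ℂ) : Set (Fin 4 → ℂ) :=
  {x | Fmap M x = 0 ∧ x 0 ≠ x 1 ∧ x 2 ≠ x 3}

/-- The 4×4 Jacobian matrix of `F(·; M)` with respect to `(t₁, t₂, s₁, s₂)`. -/
def Jac (M : Matrix (Fin 4) (Fin 4) ℂ) (x : Fin 4 → ℂ) : Matrix (Fin 4) (Fin 4) ℂ :=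
  fun i j => deriv (fun z => Fmap M (Function.update x j z) i) (x j)

/-- A real matrix viewed as a complex matrix. -/
def cm (M : Matrix (Fin 4) (Fin 4) ℝ) : Matrix (Fin 4) (Fin 4) ℂ :=
  M.map Complex.ofReal

/-- The matrix of Example 2.3, with the decimal entries taken as exact rationals. -/
def M₁₆ : Matrix (Fin 4) (Fin 4) ℚ :=
  !![1, 0, 0, 0;
     1.4351, 0.6797, 3.9435, 7.7238;
     -1.3085, 4.6694, 13.1949, 5.1509;
     1.1573, 1.2007, 5.7272, 8.6591]

attribute [local instance] Matrix.linftyOpNormedAddCommGroup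

theorem linfty_opNorm_le_of_entry_le {m n : Type*} [Fintype m] [Fintype n] {A : Matrix m n ℝ} {c : ℝ}
    (hc : 0 ≤ c) (h : ∀ i j, |A i j| ≤ c) : ‖A‖ ≤ Fintype.card n * c := by
  rw [Matrix.linfty_opNorm_def]
  lift c to NNReal using hc
  norm_cast
  refine Finset.sup_le fun i _ => ?_
  calc ∑ j, ‖A i j‖₊ ≤ ∑ _j : n, c := Finset.sum_le_sum fun j _ => by exact_mod_cast h i j
    _ = _ := by simp

/-- If `A` is an approximate right inverse of all divided differences of `G` near `x₀` and `G x₀` is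
small, then `G` has a zero near `x₀`. -/
theorem exists_zero_of_approx_right_inverse {n : Type*} [Fintype n] [DecidableEq n]
    {G : (n → ℝ) → n → ℝ} {J : (n → ℝ) → (n → ℝ) → Matrix n n ℝ}
    (hJ : ∀ x y, G x - G y = J x y *ᵥ (x - y)) {x₀ : n → ℝ} {A : Matrix n n ℝ} {r : ℝ}
    (hA : ∀ x y, ‖x - x₀‖ ≤ r → ‖y - x₀‖ ≤ r → ‖1 - J x y * A‖ ≤ 1 / 2)
    (h₀ : ‖A‖ * (2 * ‖G x₀‖) ≤ r) : ∃ x, ‖x - x₀‖ ≤ r ∧ G x = 0 := by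
  set ρ := 2 * ‖G x₀‖ with hρ
  set T : (n → ℝ) → n → ℝ := fun z => z - G (x₀ + A *ᵥ z) with hT
  have hnear : ∀ z ∈ Metric.closedBall (0 : n → ℝ) ρ, ‖x₀ + A *ᵥ z - x₀‖ ≤ r := fun z hz => by
    rw [add_sub_cancel_left]
    refine (Matrix.linfty_opNorm_mulVec A z).trans (le_trans ?_ h₀)
    exact mul_le_mul_of_nonneg_left (by simpa using hz) (norm_nonneg _)
  have hlip : ∀ z ∈ Metric.closedBall (0 : n → ℝ) ρ, ∀ w ∈ Metric.closedBall (0 : n → ℝ) ρ,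
      ‖T z - T w‖ ≤ 1 / 2 * ‖z - w‖ := fun z hz w hw => by
    have : T z - T w = (1 - J (x₀ + A *ᵥ z) (x₀ + A *ᵥ w) * A) *ᵥ (z - w) := by
      rw [Matrix.sub_mulVec, Matrix.one_mulVec, ← Matrix.mulVec_mulVec, Matrix.mulVec_sub A,
        ← add_sub_add_left_eq_sub (A *ᵥ z) _ x₀, ← hJ]
      simp only [hT]
      abel
    rw [this]
    exact (Matrix.linfty_opNorm_mulVec _ _).trans
      (mul_le_mul_of_nonneg_right (hA _ _ (hnear z hz) (hnear w hw)) (norm_nonneg _))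
  have hzero : (0 : n → ℝ) ∈ Metric.closedBall (0 : n → ℝ) ρ := by simp [hρ]
  have hmaps : Set.MapsTo T (Metric.closedBall 0 ρ) (Metric.closedBall 0 ρ) := fun z hz => by
    have h1 := hlip z hz 0 hzero
    have h2 : ‖T 0‖ = ‖G x₀‖ := by simp [hT]
    have h3 := norm_le_norm_sub_add (T z) (T 0)
    simp only [mem_closedBall_zero_iff, sub_zero] at *
    linarith
  have hcontr : ContractingWith (1 / 2) (hmaps.restrict T _ _) := by
    refine ⟨by norm_num, LipschitzWith.of_dist_le_mul fun z w => ?_⟩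
    simpa [Subtype.dist_eq, dist_eq_norm] using hlip z z.2 w w.2
  obtain ⟨z, hz, hfix, -⟩ := hcontr.exists_fixedPoint' Metric.isClosed_closedBall.isComplete hmaps
    hzero (edist_ne_top _ _)
  refine ⟨_, hnear z hz, ?_⟩
  simpa [hT, Function.IsFixedPt] using hfix

/-- The monomials of degree at most three in two variables. -/
def cubicMonomials {K : Type*} [Field K] (p : K × K) : Fin 10 → K :=
  ![1, p.1, p.2, p.1 ^ 2, p.1 * p.2, p.2 ^ 2, p.1 ^ 3, p.1 ^ 2 * p.2, p.1 * p.2 ^ 2, p.2 ^ 3]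

/-- The monomials of degree four in two variables. -/
def quarticMonomials {K : Type*} [Field K] (p : K × K) : Fin 5 → K :=
  ![p.1 ^ 4, p.1 ^ 3 * p.2, p.1 ^ 2 * p.2 ^ 2, p.1 * p.2 ^ 3, p.2 ^ 4]

/-- Points of the plane on which every quartic monomial agrees with a fixed polynomial of degree at
most three number at most ten. -/
theorem card_le_ten_of_quarticMonomials_eq {K ι : Type*} [Field K] [Fintype ι] {p : ι → K × K}
    (hp : Function.Injective p) (C : Matrix (Fin 5) (Fin 10) K)
    (hC : ∀ i, quarticMonomials (p i) = C *ᵥ cubicMonomials (p i)) : Fintype.card ι ≤ 10 := by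
  classical
  set m : Fin 10 → ι → K := fun k i => cubicMonomials (p i) k with hm
  set W := Submodule.span K (Set.range m) with hW
  have hmem : ∀ k, m k ∈ W := fun k => Submodule.subset_span ⟨k, rfl⟩
  have hquartic : ∀ l, (fun i => quarticMonomials (p i) l) ∈ W := fun l => by
    have : (fun i => quarticMonomials (p i) l) = ∑ k, C l k • m k := by
      ext i
      simp [hC, hm, Matrix.mulVec, dotProduct]
    rw [this]
    exact W.sum_mem fun k _ => W.smul_mem _ (hmem k)
  have hclosed : ∀ u : ι → K, (∀ k, u * m k ∈ W) → ∀ f ∈ W, u * f ∈ W := fun u hu f hf => by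
    have : W ≤ W.comap (LinearMap.mulLeft K u) := by
      rw [hW, Submodule.span_le]
      rintro _ ⟨k, rfl⟩
      exact hu k
    exact this hf
  have hfst : ∀ f ∈ W, (fun i => (p i).1) * f ∈ W := by
    refine hclosed _ fun k => ?_
    fin_cases k
    · convert hmem 1 using 1; ext; simp [hm, cubicMonomials]
    · convert hmem 3 using 1; ext; simp [hm, cubicMonomials]; ring
    · convert hmem 4 using 1; ext; simp [hm, cubicMonomials]
    · convert hmem 6 using 1; ext; simp [hm, cubicMonomials]; ring
    · convert hmem 7 using 1; ext; simp [hm, cubicMonomials]; ring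
    · convert hmem 8 using 1; ext; simp [hm, cubicMonomials]
    · convert hquartic 0 using 1; ext; simp [hm, cubicMonomials, quarticMonomials]; ring
    · convert hquartic 1 using 1; ext; simp [hm, cubicMonomials, quarticMonomials]; ring
    · convert hquartic 2 using 1; ext; simp [hm, cubicMonomials, quarticMonomials]; ring
    · convert hquartic 3 using 1; ext; simp [hm, cubicMonomials, quarticMonomials]
  have hsnd : ∀ f ∈ W, (fun i => (p i).2) * f ∈ W := by
    refine hclosed _ fun k => ?_
    fin_cases k
    · convert hmem 2 using 1; ext; simp [hm, cubicMonomials]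
    · convert hmem 4 using 1; ext; simp [hm, cubicMonomials]; ring
    · convert hmem 5 using 1; ext; simp [hm, cubicMonomials]; ring
    · convert hmem 7 using 1; ext; simp [hm, cubicMonomials]; ring
    · convert hmem 8 using 1; ext; simp [hm, cubicMonomials]; ring
    · convert hmem 9 using 1; ext; simp [hm, cubicMonomials]; ring
    · convert hquartic 1 using 1; ext; simp [hm, cubicMonomials, quarticMonomials]; ring
    · convert hquartic 2 using 1; ext; simp [hm, cubicMonomials, quarticMonomials]; ring
    · convert hquartic 3 using 1; ext; simp [hm, cubicMonomials, quarticMonomials]; ring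
    · convert hquartic 4 using 1; ext; simp [hm, cubicMonomials, quarticMonomials]; ring
  have hone : (1 : ι → K) ∈ W := by
    convert hmem 0 using 1
    ext
    simp [hm, cubicMonomials]
  have hsep : ∀ i j, i ≠ j → ∃ u : ι → K, (∀ f ∈ W, u * f ∈ W) ∧ u i ≠ 0 ∧ u j = 0 := by
    intro i j hij
    have hsub : ∀ (v : ι → K), (∀ f ∈ W, v * f ∈ W) → ∀ f ∈ W, (fun k => v k - v j) * f ∈ W := by
      intro v hv f hf
      have : (fun k => v k - v j) * f = v * f - v j • f := by
        ext
        simp [sub_mul]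
      rw [this]
      exact W.sub_mem (hv f hf) (W.smul_mem _ hf)
    by_cases h : (p i).1 = (p j).1
    · exact ⟨_, hsub _ hsnd, sub_ne_zero.2 fun h' => hij (hp (Prod.ext h h')), sub_self _⟩
    · exact ⟨_, hsub _ hfst, sub_ne_zero.2 h, sub_self _⟩
  choose! u hu hu₁ hu₀ using hsep
  have hprod : ∀ i, ∀ s : Finset ι, i ∉ s → ∏ j ∈ s, u i j ∈ W := by
    intro i s
    induction s using Finset.induction_on with
    | empty => simpa using hone
    | insert j s hj ih =>
      intro hi
      rw [Finset.mem_insert, not_or] at hi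
      rw [Finset.prod_insert hj]
      exact hu i j hi.1 _ (ih hi.2)
  have hsingle : ∀ i, Pi.single i (1 : K) ∈ W := by
    intro i
    set c := ∏ j ∈ Finset.univ.erase i, u i j i with hc
    have hc₀ : c ≠ 0 := Finset.prod_ne_zero_iff.2 fun j hj => hu₁ i j (Finset.ne_of_mem_erase hj).symm
    have : Pi.single i (1 : K) = c⁻¹ • ∏ j ∈ Finset.univ.erase i, u i j := by
      ext k
      by_cases hk : k = i
      · subst hk
        simp [Finset.prod_apply, ← hc, hc₀]
      · have : ∏ j ∈ Finset.univ.erase i, u i j k = 0 :=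
          Finset.prod_eq_zero (Finset.mem_erase.2 ⟨hk, Finset.mem_univ k⟩) (hu₀ i k (Ne.symm hk))
        rw [Pi.single_eq_of_ne hk, Pi.smul_apply, Finset.prod_apply, this, smul_zero]
    rw [this]
    exact W.smul_mem _ (hprod i _ (Finset.notMem_erase i _))
  have htop : W = ⊤ := by
    refine eq_top_iff.2 fun f _ => ?_
    rw [pi_eq_sum_univ' f]
    exact W.sum_mem fun i _ => W.smul_mem _ (hsingle i)
  have := finrank_range_le_card (R := K) m
  rwa [Set.finrank, ← hW, htop, finrank_top, Module.finrank_fintype_fun_eq_card,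
    Fintype.card_fin] at this

/-- The constant coefficient of the remainder of `pᵢ(s; M)` modulo `s² - as + b`. -/
def remConst {K : Type*} [Field K] (M : Matrix (Fin 4) (Fin 4) K) (i : Fin 4) (a b : K) : K :=
  M i 0 - M i 2 * b - M i 3 * (a * b)

/-- The linear coefficient of the remainder of `pᵢ(s; M)` modulo `s² - as + b`. -/
def remLin {K : Type*} [Field K] (M : Matrix (Fin 4) (Fin 4) K) (i : Fin 4) (a b : K) : K :=
  M i 1 + M i 2 * a + M i 3 * (a ^ 2 - b)

/-- The system `F(·; M)` rewritten in `(t₁ + t₂, t₁t₂, s₁ + s₂, s₁s₂)`. -/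
def secantSystem {K : Type*} [Field K] (M : Matrix (Fin 4) (Fin 4) K) (x : Fin 4 → K) :
    Fin 4 → K :=
  ![remConst M 2 (x 2) (x 3) - x 0 * remConst M 1 (x 2) (x 3) + x 1 * remConst M 0 (x 2) (x 3),
    remLin M 2 (x 2) (x 3) - x 0 * remLin M 1 (x 2) (x 3) + x 1 * remLin M 0 (x 2) (x 3),
    remConst M 3 (x 2) (x 3) - x 0 * remConst M 2 (x 2) (x 3) + x 1 * remConst M 1 (x 2) (x 3),
    remLin M 3 (x 2) (x 3) - x 0 * remLin M 2 (x 2) (x 3) + x 1 * remLin M 1 (x 2) (x 3)]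

theorem secantSystem_map {K L : Type*} [Field K] [Field L] (f : K →+* L)
    (M : Matrix (Fin 4) (Fin 4) K) (x : Fin 4 → K) :
    secantSystem (M.map f) (f ∘ x) = f ∘ secantSystem M x := by
  ext i
  fin_cases i <;> simp [secantSystem, remConst, remLin]

theorem pc_eq_rem (M : Matrix (Fin 4) (Fin 4) ℂ) (i : Fin 4) {a b s : ℂ} (h : s ^ 2 = a * s - b) :
    pc M i s = remConst M i a b + remLin M i a b * s := by
  simp only [pc, tcv, Matrix.mulVec, dotProduct, Fin.sum_univ_four, remConst, remLin,
    Matrix.cons_val]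
  linear_combination (M i 2 + M i 3 * (s + a)) * h

theorem affine_eq_zero_iff {K : Type*} [Field K] {s₁ s₂ c d : K} (hs : s₁ ≠ s₂) :
    c + d * s₁ = 0 ∧ c + d * s₂ = 0 ↔ c = 0 ∧ d = 0 := by
  refine ⟨fun ⟨h₁, h₂⟩ => ?_, fun ⟨hc, hd⟩ => by simp [hc, hd]⟩
  have hd : d = 0 := by
    have : d * (s₁ - s₂) = 0 := by linear_combination h₁ - h₂
    exact (mul_eq_zero.1 this).resolve_right (sub_ne_zero.2 hs)
  exact ⟨by simpa [hd] using h₁, hd⟩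

theorem Fmap_eq_zero_iff (M : Matrix (Fin 4) (Fin 4) ℂ) {x : Fin 4 → ℂ} (hx : x 2 ≠ x 3) :
    Fmap M x = 0 ↔ secantSystem M ![x 0 + x 1, x 0 * x 1, x 2 + x 3, x 2 * x 3] = 0 := by
  set y : Fin 4 → ℂ := ![x 0 + x 1, x 0 * x 1, x 2 + x 3, x 2 * x 3] with hy
  have key : ∀ s : ℂ, s ^ 2 = (x 2 + x 3) * s - x 2 * x 3 →
      f₁ M (x 0) (x 1) s = secantSystem M y 0 + secantSystem M y 1 * s ∧
      f₂ M (x 0) (x 1) s = secantSystem M y 2 + secantSystem M y 3 * s := by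
    intro s hs
    simp only [f₁, f₂, pc_eq_rem M _ hs, secantSystem, hy, Matrix.cons_val]
    constructor <;> ring
  obtain ⟨h1, h2⟩ := key (x 2) (by ring)
  obtain ⟨h3, h4⟩ := key (x 3) (by ring)
  have e₁ := affine_eq_zero_iff (c := secantSystem M y 0) (d := secantSystem M y 1) hx
  have e₂ := affine_eq_zero_iff (c := secantSystem M y 2) (d := secantSystem M y 3) hx
  simp only [funext_iff, Fin.forall_fin_succ, Fmap, h1, h2, h3, h4]
  simp [Matrix.cons_val] at *
  tauto

/-- The coefficients of the quartic monomials in the five quartic equations, scaled by `10¹⁶`. -/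
def quarticCoeff : Matrix (Fin 5) (Fin 5) ℤ :=
  !![1755054500665820000, -2515212602137620000, -6302790296473860000, 0,
       0;
     -631937888965550000, 1415650581379090000, 3424025190095850000, 0,
       0;
     -4397593329997942321, 14041931760211171222, 24500494837421411765, -53146603457631944106,
       -66589181423196985809;
     -1501010415105315563, 3492828297842936504, 7873862767047823827, -6050281695460876482,
       -8232507983164385997;
     -4644741083237017477, 14825807369123695133, 25716733156767227107, -56231123867645457244,
       -70180326590396416518]

/-- The negated coefficients of the cubic monomials in the five quartic equations, scaled by
`10¹⁶`. -/
def cubicCoeff : Matrix (Fin 5) (Fin 10) ℤ :=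
  !![158279561978170000, 682857810395570000, 439971364062040000, 189200875305950000,
       2569520611056250000, -1929933157221290000, -1975708404693270000, 5523816661880350000,
       702769936786830000, -6302790296473860000;
     348062720407940000, 2064917137605580000, -1547326781030910000, 4147322668032610000,
       -5840827454066370000, -2688358274136010000, 3130220121885360000, -5848565689949110000,
       -8953833967721090000, 3424025190095850000;
     623557469006236921, 4087787137665148172, -4820666530295956828, 10016641158804318218,
       -21031174374000569370, -3526889024770129590, 10873151021962309572, -29986684522343257280,
       -22474697816021463008, 50519915320725338844;
     396776328309337064, 2486425903742251987, -2256633676351033768, 5479847951942483635,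
       -9081960351719808559, -2868774107839697833, 4934260379601053871, -10566049369191474703,
       -12510065108380345287, 10617395938627858942;
     621953824344626299, 4149900819013349885, -5042728805869979301, 10332691955627042312,
       -22174520167507488052, -3107380269204178734, 11366579273137173519, -31707263194513219720,
       -22923757209098908474, 54053741541004605741]

theorem det_quarticCoeff_ne_zero : quarticCoeff.det ≠ 0 := by
  decide +kernel

/-- The quartics are `2 × 2` minors of the symmetric `3 × 3` matrix of Plücker coordinates that has
rank one exactly at the secants of the standard twisted cubic. -/
theorem quarticCoeff_mulVec_eq {K : Type*} [Field K] [CharZero K] {x : Fin 4 → K}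
    (hx : secantSystem (M₁₆.map (algebraMap ℚ K)) x = 0) :
    (quarticCoeff.map (Int.castRingHom K)) *ᵥ quarticMonomials (x 2, x 3) =
      (cubicCoeff.map (Int.castRingHom K)) *ᵥ cubicMonomials (x 2, x 3) := by
  set M := M₁₆.map (algebraMap ℚ K) with hM
  have g₀ := congrFun hx 0
  have g₁ := congrFun hx 1
  have g₂ := congrFun hx 2
  have g₃ := congrFun hx 3
  have hA : remConst M 0 (x 2) (x 3) = 1 := by simp [remConst, hM, M₁₆]
  have hB : remLin M 0 (x 2) (x 3) = 0 := by simp [remLin, hM, M₁₆]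
  simp only [secantSystem, Matrix.cons_val, Pi.zero_apply, hA, hB] at g₀ g₁ g₂ g₃
  have e₁ : remLin M 2 (x 2) (x 3) = x 0 * remLin M 1 (x 2) (x 3) := by linear_combination g₁
  have e₂ : remLin M 3 (x 2) (x 3) = (x 0 ^ 2 - x 1) * remLin M 1 (x 2) (x 3) := by
    linear_combination g₃ + x 0 * g₁
  have e₃ : remConst M 2 (x 2) (x 3) = x 0 * remConst M 1 (x 2) (x 3) - x 1 := by
    linear_combination g₀
  have e₄ : remConst M 3 (x 2) (x 3) =
      x 0 * remConst M 2 (x 2) (x 3) - x 1 * remConst M 1 (x 2) (x 3) := by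
    linear_combination g₂
  set q : Fin 4 → Fin 4 → K := fun i j =>
    remConst M i (x 2) (x 3) * remLin M j (x 2) (x 3) -
      remConst M j (x 2) (x 3) * remLin M i (x 2) (x 3) with hq
  have h₀ : q 0 1 * (q 0 3 + q 1 2) - q 0 2 ^ 2 = 0 := by
    simp only [hq, hA, hB, e₁, e₂, e₃, e₄]; ring
  have h₁ : q 0 1 * q 1 3 - q 0 2 * q 1 2 = 0 := by
    simp only [hq, hA, hB, e₁, e₂, e₃, e₄]; ring
  have h₂ : q 0 1 * q 2 3 - q 1 2 ^ 2 = 0 := by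
    simp only [hq, hA, hB, e₁, e₂, e₃, e₄]; ring
  have h₃ : q 0 2 * q 2 3 - q 1 2 * q 1 3 = 0 := by
    simp only [hq, hA, hB, e₁, e₂, e₃, e₄]; ring
  have h₄ : (q 0 3 + q 1 2) * q 2 3 - q 1 3 ^ 2 = 0 := by
    simp only [hq, hA, hB, e₁, e₂, e₃, e₄]; ring
  simp only [hq, remConst, remLin, hM, M₁₆, Matrix.map_apply, Matrix.of_apply, Matrix.cons_val,
    eq_ratCast] at h₀ h₁ h₂ h₃ h₄
  norm_num at h₀ h₁ h₂ h₃ h₄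
  ext i
  fin_cases i <;>
    simp [quarticCoeff, cubicCoeff, quarticMonomials, cubicMonomials, Matrix.mulVec, dotProduct,
      Fin.sum_univ_succ]
  · linear_combination 10 ^ 16 * h₀
  · linear_combination 10 ^ 16 * h₁
  · linear_combination 10 ^ 16 * h₂
  · linear_combination 10 ^ 16 * h₃
  · linear_combination 10 ^ 16 * h₄

theorem quarticMonomials_eq {K : Type*} [Field K] [CharZero K] {x : Fin 4 → K}
    (hx : secantSystem (M₁₆.map (algebraMap ℚ K)) x = 0) :
    quarticMonomials (x 2, x 3) =
      ((quarticCoeff.map (Int.castRingHom K))⁻¹ * cubicCoeff.map (Int.castRingHom K)) *ᵥ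
        cubicMonomials (x 2, x 3) := by
  have hdet : IsUnit (quarticCoeff.map (Int.castRingHom K)).det := by
    rw [← RingHom.mapMatrix_apply, ← RingHom.map_det]
    simpa using det_quarticCoeff_ne_zero
  rw [← Matrix.mulVec_mulVec, ← quarticCoeff_mulVec_eq hx, Matrix.mulVec_mulVec,
    Matrix.nonsing_inv_mul _ hdet, Matrix.one_mulVec]

theorem secantSystem_fiber {K : Type*} [Field K] [CharZero K] {x y : Fin 4 → K}
    (hx : secantSystem (M₁₆.map (algebraMap ℚ K)) x = 0)
    (hy : secantSystem (M₁₆.map (algebraMap ℚ K)) y = 0) (h₂ : x 2 = y 2) (h₃ : x 3 = y 3) :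
    x = y := by
  set M := M₁₆.map (algebraMap ℚ K) with hM
  have hA : remConst M 0 (y 2) (y 3) = 1 := by simp [remConst, hM, M₁₆]
  have hB : remLin M 0 (y 2) (y 3) = 0 := by simp [remLin, hM, M₁₆]
  have g₀ := congrFun hx 0
  have g₁ := congrFun hx 1
  have k₀ := congrFun hy 0
  have k₁ := congrFun hy 1
  have k₃ := congrFun hy 3
  simp only [secantSystem, Matrix.cons_val, Pi.zero_apply, h₂, h₃, hA, hB] at g₀ g₁ k₀ k₁ k₃
  have hne : remLin M 1 (y 2) (y 3) ≠ 0 := by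
    intro h
    have e₂ : remLin M 2 (y 2) (y 3) = 0 := by linear_combination k₁ + y 0 * h
    have e₃ : remLin M 3 (y 2) (y 3) = 0 := by linear_combination k₃ + y 0 * e₂ - y 1 * h
    simp only [remLin, hM, M₁₆, Matrix.map_apply, Matrix.of_apply, Matrix.cons_val,
      eq_ratCast] at h e₂ e₃
    norm_num at h e₂ e₃
    have : (1 : K) = 0 := by
      linear_combination 10 ^ 4 / 6736356627232 * (8475572411 * h + 1008858651 * e₂ - 8160219447 * e₃)
    exact one_ne_zero this
  have e₀ : x 0 = y 0 := mul_right_cancel₀ hne (by linear_combination k₁ - g₁)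
  have e₁ : x 1 = y 1 := by
    linear_combination g₀ - k₀ + remConst M 1 (y 2) (y 3) * e₀
  ext i
  fin_cases i
  exacts [e₀, e₁, h₂, h₃]

/-- At most ten lines are common secants, distinguished by `(s₁ + s₂, s₁s₂)`. -/
theorem card_secantSystem_le_ten {K ι : Type*} [Field K] [CharZero K] [Fintype ι]
    {y : ι → Fin 4 → K} (hy : Function.Injective y)
    (h : ∀ i, secantSystem (M₁₆.map (algebraMap ℚ K)) (y i) = 0) : Fintype.card ι ≤ 10 := by
  refine card_le_ten_of_quarticMonomials_eq (p := fun i => (y i 2, y i 3)) (fun i j hij => ?_) _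
    fun i => quarticMonomials_eq (h i)
  simp only [Prod.mk.injEq] at hij
  exact hy (secantSystem_fiber (h i) (h j) hij.1 hij.2)

/-- The matrix of divided differences of `secantSystem M` between `x` and `y`. -/
def secantDiff {K : Type*} [Field K] (M : Matrix (Fin 4) (Fin 4) K) (x y : Fin 4 → K) :
    Matrix (Fin 4) (Fin 4) K :=
  let da (i : Fin 4) : K := -(M i 3 * y 3)
  let db (i : Fin 4) : K := -M i 2 - M i 3 * x 2
  let ea (i : Fin 4) : K := M i 2 + M i 3 * (x 2 + y 2)
  let eb (i : Fin 4) : K := -M i 3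
  !![-remConst M 1 (x 2) (x 3), remConst M 0 (x 2) (x 3),
      da 2 - y 0 * da 1 + y 1 * da 0, db 2 - y 0 * db 1 + y 1 * db 0;
     -remLin M 1 (x 2) (x 3), remLin M 0 (x 2) (x 3),
      ea 2 - y 0 * ea 1 + y 1 * ea 0, eb 2 - y 0 * eb 1 + y 1 * eb 0;
     -remConst M 2 (x 2) (x 3), remConst M 1 (x 2) (x 3),
      da 3 - y 0 * da 2 + y 1 * da 1, db 3 - y 0 * db 2 + y 1 * db 1;
     -remLin M 2 (x 2) (x 3), remLin M 1 (x 2) (x 3),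
      ea 3 - y 0 * ea 2 + y 1 * ea 1, eb 3 - y 0 * eb 2 + y 1 * eb 1]

theorem secantDiff_map {K L : Type*} [Field K] [Field L] (f : K →+* L)
    (M : Matrix (Fin 4) (Fin 4) K) (x y : Fin 4 → K) :
    secantDiff (M.map f) (f ∘ x) (f ∘ y) = (secantDiff M x y).map f := by
  ext i j
  fin_cases i <;> fin_cases j <;> simp [secantDiff, remConst, remLin]

theorem secantSystem_sub {K : Type*} [Field K] (M : Matrix (Fin 4) (Fin 4) K) (x y : Fin 4 → K) :
    secantSystem M x - secantSystem M y = secantDiff M x y *ᵥ (x - y) := by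
  ext i
  fin_cases i <;>
    simp [secantSystem, secantDiff, remConst, remLin, Matrix.mulVec, dotProduct,
      Fin.sum_univ_four] <;>
    ring

theorem abs_mul_sub_mul_le {u v u₀ v₀ r : ℝ} (hu : |u| ≤ 4) (hv₀ : |v₀| ≤ 4)
    (hu' : |u - u₀| ≤ r) (hv' : |v - v₀| ≤ r) : |u * v - u₀ * v₀| ≤ 8 * r := by
  have : u * v - u₀ * v₀ = u * (v - v₀) + (u - u₀) * v₀ := by ring
  rw [this]
  refine (abs_add_le _ _).trans ?_
  rw [abs_mul, abs_mul]
  have := (abs_nonneg _).trans hu'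
  nlinarith [abs_nonneg u, abs_nonneg v₀, abs_nonneg (v - v₀), abs_nonneg (u - u₀)]

set_option maxHeartbeats 1600000 in
theorem abs_secantDiff_sub_le {x y c : Fin 4 → ℝ} (hc : ∀ i, |c i| ≤ 3)
    (hx : ‖x - c‖ ≤ 1 / 10 ^ 7) (hy : ‖y - c‖ ≤ 1 / 10 ^ 7) (i j : Fin 4) :
    |secantDiff (M₁₆.map (algebraMap ℚ ℝ)) x y i j -
      secantDiff (M₁₆.map (algebraMap ℚ ℝ)) c c i j| ≤ 1 / 10 ^ 3 := by
  have hx' : ∀ k, |x k - c k| ≤ 1 / 10 ^ 7 := fun k => (norm_le_pi_norm (x - c) k).trans hx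
  have hy' : ∀ k, |y k - c k| ≤ 1 / 10 ^ 7 := fun k => (norm_le_pi_norm (y - c) k).trans hy
  have hc' : ∀ k, |c k| ≤ 4 := fun k => (hc k).trans (by norm_num)
  have hbd : ∀ u v : ℝ, |v| ≤ 3 → |u - v| ≤ 1 / 10 ^ 7 → |u| ≤ 4 := fun u v hv h => by
    rw [abs_le] at *
    constructor <;> linarith
  have hxb : ∀ k, |x k| ≤ 4 := fun k => hbd _ _ (hc k) (hx' k)
  have hyb : ∀ k, |y k| ≤ 4 := fun k => hbd _ _ (hc k) (hy' k)
  have p₁ := abs_le.1 (abs_mul_sub_mul_le (hxb 2) (hc' 3) (hx' 2) (hx' 3))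
  have p₂ := abs_le.1 (abs_mul_sub_mul_le (hxb 2) (hc' 2) (hx' 2) (hx' 2))
  have p₃ := abs_le.1 (abs_mul_sub_mul_le (hyb 0) (hc' 3) (hy' 0) (hy' 3))
  have p₄ := abs_le.1 (abs_mul_sub_mul_le (hyb 1) (hc' 3) (hy' 1) (hy' 3))
  have p₅ := abs_le.1 (abs_mul_sub_mul_le (hyb 0) (hc' 2) (hy' 0) (hx' 2))
  have p₆ := abs_le.1 (abs_mul_sub_mul_le (hyb 1) (hc' 2) (hy' 1) (hx' 2))
  have p₇ := abs_le.1 (abs_mul_sub_mul_le (hyb 0) (hc' 2) (hy' 0) (hy' 2))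
  have p₈ := abs_le.1 (abs_mul_sub_mul_le (hyb 1) (hc' 2) (hy' 1) (hy' 2))
  have x₂ := abs_le.1 (hx' 2)
  have x₃ := abs_le.1 (hx' 3)
  have y₀ := abs_le.1 (hy' 0)
  have y₁ := abs_le.1 (hy' 1)
  have y₂ := abs_le.1 (hy' 2)
  have y₃ := abs_le.1 (hy' 3)
  rw [abs_le]
  fin_cases i <;> fin_cases j <;>
    simp only [secantDiff, remConst, remLin, M₁₆, Matrix.map_apply, Matrix.of_apply,
      Matrix.cons_val, eq_ratCast, Fin.zero_eta, Fin.mk_one, Fin.reduceFinMk, Fin.isValue] <;>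
    norm_num <;>
    constructor <;> linarith

theorem secantSystem_exists_zero {c : Fin 4 → ℚ} {A : Matrix (Fin 4) (Fin 4) ℚ}
    (hc : ∀ i, |c i| ≤ 3) (hA : ∀ i j, |A i j| ≤ 10)
    (hJ : ∀ i j, |(1 - secantDiff M₁₆ c c * A) i j| ≤ 1 / 16)
    (h₀ : ∀ i, |secantSystem M₁₆ c i| ≤ 1 / 10 ^ 10) :
    ∃ y : Fin 4 → ℝ, secantSystem (M₁₆.map (algebraMap ℚ ℝ)) y = 0 ∧
      ∀ i, |y i - c i| ≤ 1 / 10 ^ 7 := by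
  set A' : Matrix (Fin 4) (Fin 4) ℝ := A.map (algebraMap ℚ ℝ) with hA'
  set c' : Fin 4 → ℝ := algebraMap ℚ ℝ ∘ c with hc'
  have bA : ∀ i j, |A' i j| ≤ 10 := fun i j => by
    simp only [hA', Matrix.map_apply, eq_ratCast]
    exact_mod_cast hA i j
  have bc : ∀ i, |c' i| ≤ 3 := fun i => by
    simp only [hc', Function.comp_apply, eq_ratCast]
    exact_mod_cast hc i
  have bJ : ∀ i j, |(1 - secantDiff (M₁₆.map (algebraMap ℚ ℝ)) c' c' * A') i j| ≤ 1 / 16 := by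
    intro i j
    have : 1 - secantDiff (M₁₆.map (algebraMap ℚ ℝ)) c' c' * A' =
        (1 - secantDiff M₁₆ c c * A).map (algebraMap ℚ ℝ) := by
      rw [secantDiff_map, hA', ← RingHom.mapMatrix_apply, ← RingHom.mapMatrix_apply,
        ← RingHom.mapMatrix_apply, map_sub, map_mul, map_one]
    rw [this, Matrix.map_apply, eq_ratCast]
    have := (Rat.cast_le (K := ℝ)).2 (hJ i j)
    push_cast at this
    exact this
  have b₀ : ‖secantSystem (M₁₆.map (algebraMap ℚ ℝ)) c'‖ ≤ 1 / 10 ^ 10 := by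
    refine (pi_norm_le_iff_of_nonneg (by norm_num)).2 fun i => ?_
    rw [hc', secantSystem_map, Function.comp_apply, eq_ratCast, Real.norm_eq_abs]
    have := (Rat.cast_le (K := ℝ)).2 (h₀ i)
    push_cast at this
    exact this
  have nA : ‖A'‖ ≤ 40 :=
    (linfty_opNorm_le_of_entry_le (by norm_num) bA).trans (by norm_num)
  obtain ⟨y, hy, hy₀⟩ := exists_zero_of_approx_right_inverse
    (secantSystem_sub (M₁₆.map (algebraMap ℚ ℝ))) (x₀ := c') (A := A') (r := 1 / 10 ^ 7)
    (fun x y hx hy => by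
      refine (linfty_opNorm_le_of_entry_le (c := 1 / 8) (by norm_num) fun i j => ?_).trans
        (by norm_num)
      set D := secantDiff (M₁₆.map (algebraMap ℚ ℝ)) x y
      set D₀ := secantDiff (M₁₆.map (algebraMap ℚ ℝ)) c' c'
      have hsplit : (1 - D * A') i j =
          (1 - D₀ * A') i j - ∑ k, (D i k - D₀ i k) * A' k j := by
        simp only [Matrix.sub_apply, Matrix.mul_apply, sub_mul, Finset.sum_sub_distrib]
        ring
      have hsum : |∑ k, (D i k - D₀ i k) * A' k j| ≤ ∑ _k : Fin 4, (1 / 10 ^ 3 * 10 : ℝ) := by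
        refine (Finset.abs_sum_le_sum_abs _ _).trans (Finset.sum_le_sum fun k _ => ?_)
        rw [abs_mul]
        exact mul_le_mul (abs_secantDiff_sub_le bc hx hy i k) (bA k j) (abs_nonneg _) (by norm_num)
      rw [hsplit]
      refine (abs_sub _ _).trans ((add_le_add (bJ i j) hsum).trans (by norm_num)))
    ((mul_le_mul nA (mul_le_mul_of_nonneg_left b₀ zero_le_two) (by positivity)
      (by norm_num)).trans (by norm_num))
  refine ⟨y, hy₀, fun i => ?_⟩
  simpa [hc'] using (norm_le_pi_norm (y - c') i).trans hy

/-- Approximations of `(t₁ + t₂, t₁t₂, s₁ + s₂, s₁s₂)` for the ten common secants, ordered by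
`s₁ + s₂`. -/
def approxSecant : Fin 10 → Fin 4 → ℚ :=
  ![![0.023444672075, -1.038993274355, -2.911958052674, 1.738748225577],
    ![-0.055344217858, -1.023863721741, -1.556372189088, -0.476194378573],
    ![-0.896293833800, -0.112402263044, -1.409305405962, 0.470593013287],
    ![-0.876904218353, -0.133586558466, -0.834775822867, -0.027412584287],
    ![-0.005822242334, -1.007037861410, -0.569425851357, -0.224889167218],
    ![-0.906391626291, 0.051604000247, -0.477540184498, 0.004000116562],
    ![-0.924705976505, 0.192702817501, -0.446539504881, 0.018608741808],
    ![1.117501613115, 0.106456450431, -0.296858999078, -0.285683956376],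
    ![1.135466429241, 0.111787535962, 1.997254435783, -1.898456554443],
    ![1.172662275434, 0.192714787308, 2.891723190365, 1.026645587333]]

/-- Approximate inverses of the Jacobian matrix of the system at the points `approxSecant`. -/
def approxInverse : Fin 10 → Matrix (Fin 4) (Fin 4) ℚ :=
  ![!![0.1058, -0.0862, -0.9682, 0.7879;
       -0.0088, 0.0046, 0.0800, -0.0409;
       -0.4441, 0.2777, 3.3599, -2.7323;
       0.5371, -0.3709, -2.6718, 2.1683],
    !![0.1710, 0.0236, -0.9741, -0.1488;
       -0.0425, -0.0175, 0.2461, 0.0966;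
       -0.3037, -0.2042, 2.6784, 0.3994;
       -0.3037, -0.1063, 1.0593, 0.1688],
    !![-0.5471, 0.2935, 0.5263, -0.2823;
       1.0580, -0.7194, -1.0195, 0.6936;
       0.4464, -0.3563, -0.5875, 0.3392;
       -0.3302, 0.2618, 0.5443, -0.3265],
    !![-0.5816, 0.0763, 0.5786, -0.0701;
       1.1045, -0.4890, -1.0704, 0.4555;
       0.0348, -0.0447, 0.4137, -0.2013;
       0.1359, -0.0907, -0.2576, 0.0725],
    !![0.1107, -0.0403, -1.0331, 0.4733;
       -0.0281, -0.0339, 0.1332, 0.3179;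
       -0.0446, 0.1345, -0.2980, 0.1651;
       -0.1197, 0.0173, 0.1133, -0.0117],
    !![-0.6490, 1.0705, 0.8762, -1.1528;
       2.0156, -7.5956, -3.7148, 8.1816;
       0.3478, -1.6395, -0.9673, 1.9724;
       0.1759, -0.8254, -0.4490, 0.8881],
    !![-0.2980, -0.9627, -0.0202, 1.0368;
       -0.4533, 8.1181, 2.9479, -8.7264;
       -0.1976, 1.7960, 0.5265, -1.7550;
       -0.0866, 0.7998, 0.2516, -0.8636],
    !![0.4573, -0.5480, 0.4490, -0.5481;
       0.9550, -0.7387, 0.9488, -0.7362;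
       0.1353, -0.0401, 0.0993, -0.1355;
       -0.1071, 0.0352, -0.0006, 0.0452],
    !![0.4408, -0.3201, 0.4380, -0.3179;
       0.9498, -0.6708, 0.9436, -0.6664;
       -2.8909, 1.9779, -2.7647, 2.0086;
       1.9957, -1.3649, 2.1536, -1.5599],
    !![0.4171, 0.1487, 0.3945, 0.1405;
       0.9284, 0.3462, 0.8781, 0.3274;
       -2.2173, -0.8678, -2.1657, -0.7725;
       -0.6198, -0.2432, -0.8323, -0.3003]]

theorem approxSecant_certificate (k : Fin 10) :
    (∀ i, |approxSecant k i| ≤ 3) ∧ (∀ i j, |approxInverse k i j| ≤ 10) ∧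
      (∀ i j, |(1 - secantDiff M₁₆ (approxSecant k) (approxSecant k) * approxInverse k) i j| ≤
        1 / 16) ∧
      (∀ i, |secantSystem M₁₆ (approxSecant k) i| ≤ 1 / 10 ^ 10) ∧
      1 / 100 ≤ approxSecant k 0 ^ 2 - 4 * approxSecant k 1 ∧
      1 / 100 ≤ approxSecant k 2 ^ 2 - 4 * approxSecant k 3 ∧
      ∀ l, l < k → 1 / 100 ≤ approxSecant k 2 - approxSecant l 2 := by
  revert k
  decide +kernel

theorem exists_secants : ∃ y : Fin 10 → Fin 4 → ℝ,
    (∀ k, secantSystem (M₁₆.map (algebraMap ℚ ℝ)) (y k) = 0) ∧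
      (∀ k, 0 < y k 0 ^ 2 - 4 * y k 1) ∧ (∀ k, 0 < y k 2 ^ 2 - 4 * y k 3) ∧
      StrictMono fun k => y k 2 := by
  have h := fun k => secantSystem_exists_zero (approxSecant_certificate k).1
    (approxSecant_certificate k).2.1 (approxSecant_certificate k).2.2.1
    (approxSecant_certificate k).2.2.2.1
  choose y hy hclose using h
  have hdisc : ∀ (p q : ℝ) (c d : ℚ), |c| ≤ 3 → 1 / 100 ≤ c ^ 2 - 4 * d →
      |p - c| ≤ 1 / 10 ^ 7 → |q - d| ≤ 1 / 10 ^ 7 → 0 < p ^ 2 - 4 * q := by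
    intro p q c d hc hcd hp hq
    have hc' : |(c : ℝ)| ≤ 3 := by exact_mod_cast hc
    have hcd' : (1 / 100 : ℝ) ≤ (c : ℝ) ^ 2 - 4 * d := by
      have := (Rat.cast_le (K := ℝ)).2 hcd
      push_cast at this
      exact this
    rw [abs_le] at hc' hp hq
    nlinarith
  refine ⟨y, hy, fun k => ?_, fun k => ?_, fun l k hlk => ?_⟩
  · obtain ⟨hb, -, -, -, hd, -⟩ := approxSecant_certificate k
    exact hdisc _ _ _ _ (hb 0) hd (hclose k 0) (hclose k 1)
  · obtain ⟨hb, -, -, -, -, hd, -⟩ := approxSecant_certificate k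
    exact hdisc _ _ _ _ (hb 2) hd (hclose k 2) (hclose k 3)
  · have hsep := (approxSecant_certificate k).2.2.2.2.2.2 l hlk
    have hsep' : (1 / 100 : ℝ) ≤ (approxSecant k 2 : ℝ) - approxSecant l 2 := by
      have := (Rat.cast_le (K := ℝ)).2 hsep
      push_cast at this
      exact this
    have h₁ := abs_le.1 (hclose k 2)
    have h₂ := abs_le.1 (hclose l 2)
    show y l 2 < y k 2
    linarith

/-- The two roots of `z² - uz + v`. -/
def quadraticRoot (u v : ℝ) (σ : Bool) : ℝ :=
  (u + (bif σ then 1 else -1) * √(u ^ 2 - 4 * v)) / 2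

theorem quadraticRoot_add (u v : ℝ) (σ : Bool) :
    quadraticRoot u v σ + quadraticRoot u v (!σ) = u := by
  cases σ <;> simp [quadraticRoot] <;> ring

theorem quadraticRoot_mul {u v : ℝ} (h : 0 < u ^ 2 - 4 * v) (σ : Bool) :
    quadraticRoot u v σ * quadraticRoot u v (!σ) = v := by
  have := Real.sq_sqrt h.le
  cases σ <;> simp [quadraticRoot] <;> linear_combination (-1 / 4) * this

theorem quadraticRoot_injective {u v : ℝ} (h : 0 < u ^ 2 - 4 * v) :
    Function.Injective (quadraticRoot u v) := by
  have := Real.sqrt_pos.2 h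
  intro σ τ
  cases σ <;> cases τ <;> simp [quadraticRoot] <;> intro <;> linarith

theorem exists_eq_quadraticRoot {u v : ℝ} (h : 0 < u ^ 2 - 4 * v) {z w : ℂ} (hadd : z + w = u)
    (hmul : z * w = v) :
    ∃ σ, z = quadraticRoot u v σ ∧ w = quadraticRoot u v (!σ) := by
  have ha : (quadraticRoot u v true : ℂ) + quadraticRoot u v false = u := by
    exact_mod_cast quadraticRoot_add u v true
  have hm : (quadraticRoot u v true : ℂ) * quadraticRoot u v false = v := by
    exact_mod_cast quadraticRoot_mul h true
  have : (z - quadraticRoot u v true) * (z - quadraticRoot u v false) = 0 := by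
    linear_combination hm - z * ha + z * hadd - hmul
  rcases mul_eq_zero.1 this with hz | hz
  · exact ⟨true, sub_eq_zero.1 hz, by simp only [Bool.not_true]; linear_combination hadd - ha - hz⟩
  · exact ⟨false, sub_eq_zero.1 hz, by simp only [Bool.not_false]; linear_combination hadd - ha - hz⟩

/-- The solution given by an ordering of both pairs of points on a common secant. -/
def orderedSecant (y : Fin 4 → ℝ) (σ τ : Bool) : Fin 4 → ℂ :=
  ![quadraticRoot (y 0) (y 1) σ, quadraticRoot (y 0) (y 1) (!σ),
    quadraticRoot (y 2) (y 3) τ, quadraticRoot (y 2) (y 3) (!τ)]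

theorem secantSystem_map_ofReal (y : Fin 4 → ℝ) :
    secantSystem (M₁₆.map (algebraMap ℚ ℂ)) (Complex.ofRealHom ∘ y) =
      Complex.ofRealHom ∘ secantSystem (M₁₆.map (algebraMap ℚ ℝ)) y := by
  rw [← secantSystem_map, Matrix.map_map]
  congr

theorem orderedSecant_mem_Ssol {y : Fin 4 → ℝ}
    (hy : secantSystem (M₁₆.map (algebraMap ℚ ℝ)) y = 0) (ht : 0 < y 0 ^ 2 - 4 * y 1)
    (hs : 0 < y 2 ^ 2 - 4 * y 3) (σ τ : Bool) :
    orderedSecant y σ τ ∈ Ssol (M₁₆.map (algebraMap ℚ ℂ)) := by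
  have ht' : orderedSecant y σ τ 0 ≠ orderedSecant y σ τ 1 := by
    simpa [orderedSecant] using (quadraticRoot_injective ht).ne (by simp : σ ≠ !σ)
  have hs' : orderedSecant y σ τ 2 ≠ orderedSecant y σ τ 3 := by
    simpa [orderedSecant] using (quadraticRoot_injective hs).ne (by simp : τ ≠ !τ)
  refine ⟨(Fmap_eq_zero_iff _ hs').2 ?_, ht', hs'⟩
  have : (![orderedSecant y σ τ 0 + orderedSecant y σ τ 1,
      orderedSecant y σ τ 0 * orderedSecant y σ τ 1,
      orderedSecant y σ τ 2 + orderedSecant y σ τ 3,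
      orderedSecant y σ τ 2 * orderedSecant y σ τ 3] : Fin 4 → ℂ) = Complex.ofRealHom ∘ y := by
    ext i
    fin_cases i <;>
      simp [orderedSecant, ← Complex.ofReal_add, ← Complex.ofReal_mul, quadraticRoot_add,
        quadraticRoot_mul ht, quadraticRoot_mul hs]
  rw [this, secantSystem_map_ofReal, hy]
  ext
  simp

theorem mem_Ssol_iff {y : Fin 10 → Fin 4 → ℝ}
    (hy : ∀ k, secantSystem (M₁₆.map (algebraMap ℚ ℝ)) (y k) = 0)
    (ht : ∀ k, 0 < y k 0 ^ 2 - 4 * y k 1) (hs : ∀ k, 0 < y k 2 ^ 2 - 4 * y k 3)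
    (hinj : Function.Injective y) {x : Fin 4 → ℂ} :
    x ∈ Ssol (M₁₆.map (algebraMap ℚ ℂ)) ↔ ∃ k σ τ, orderedSecant (y k) σ τ = x := by
  refine ⟨fun ⟨hx, _, hx₂⟩ => ?_, ?_⟩
  · rw [Fmap_eq_zero_iff _ hx₂] at hx
    set z : Fin 4 → ℂ := ![x 0 + x 1, x 0 * x 1, x 2 + x 3, x 2 * x 3] with hz
    obtain ⟨k, hk⟩ : ∃ k, Complex.ofRealHom ∘ y k = z := by
      by_contra! hne
      have := card_secantSystem_le_ten
        (y := fun o : Option (Fin 10) => o.elim z fun k => Complex.ofRealHom ∘ y k) ?_ ?_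
      · simp at this
      · rintro (_ | i) (_ | j) hij
        · rfl
        · exact absurd hij.symm (hne j)
        · exact absurd hij (hne i)
        · refine congrArg some (hinj (funext fun l => ?_))
          simpa using congrFun hij l
      · rintro (_ | k)
        · exact hx
        · show secantSystem _ (Complex.ofRealHom ∘ y k) = 0
          rw [secantSystem_map_ofReal, hy]
          ext
          simp
    obtain ⟨σ, h₀, h₁⟩ := exists_eq_quadraticRoot (ht k) (z := x 0) (w := x 1)
      (congrFun hk 0).symm (congrFun hk 1).symm
    obtain ⟨τ, h₂, h₃⟩ := exists_eq_quadraticRoot (hs k) (z := x 2) (w := x 3)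
      (congrFun hk 2).symm (congrFun hk 3).symm
    refine ⟨k, σ, τ, ?_⟩
    ext i
    fin_cases i
    exacts [h₀.symm, h₁.symm, h₂.symm, h₃.symm]
  · rintro ⟨k, σ, τ, rfl⟩
    exact orderedSecant_mem_Ssol (hy k) (ht k) (hs k) σ τ

/-- For this matrix, `S(M)` has exactly 40 elements, and all of them lie in `ℝ⁴`; i.e.,
all ten common secant lines of the standard twisted cubic and its image under `M` are
totally real. -/
theorem ten_totally_real_lines :
    (Ssol (M₁₆.map (fun q => (q : ℂ)))).ncard = 40 ∧
    ∀ x ∈ Ssol (M₁₆.map (fun q => (q : ℂ))), ∀ i, (x i).im = 0 := by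
  obtain ⟨y, hy, ht, hs, hmono⟩ := exists_secants
  have hinj : Function.Injective y := fun i j hij => hmono.injective (congrFun hij 2)
  have hmem := @mem_Ssol_iff y hy ht hs hinj
  have hM : (M₁₆.map fun q => (q : ℂ)) = M₁₆.map (algebraMap ℚ ℂ) := by
    ext
    simp
  rw [hM]
  constructor
  · set Φ : Fin 10 × Bool × Bool → Fin 4 → ℂ := fun p => orderedSecant (y p.1) p.2.1 p.2.2 with hΦ
    have hrange : Ssol (M₁₆.map (algebraMap ℚ ℂ)) = Set.range Φ := by
      ext x
      simp [hmem, hΦ]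
    have hΦinj : Function.Injective Φ := by
      rintro ⟨k, σ, τ⟩ ⟨k', σ', τ'⟩ h
      have h₀ := congrFun h 0
      have h₂ := congrFun h 2
      have h₃ := congrFun h 3
      simp only [hΦ, orderedSecant, Matrix.cons_val, Complex.ofReal_inj] at h₀ h₂ h₃
      have hk : k = k' := hmono.injective <| by
        simpa only [quadraticRoot_add] using congrArg₂ (· + ·) h₂ h₃
      subst hk
      rw [quadraticRoot_injective (ht k) h₀, quadraticRoot_injective (hs k) h₂]
    rw [hrange, ← Nat.card_coe_set_eq, Nat.card_range_of_injective hΦinj]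
    simp
  · intro x hx i
    obtain ⟨k, σ, τ, rfl⟩ := hmem.1 hx
    fin_cases i <;> simp [orderedSecant]
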